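/- Fix integers m ≥ 1 and ℓ ≥ 1, and let T ∈ SSYT((m^ℓ)) be such that cw(T) acts legally on Y((m^ℓ)). If the leftmost column of T does not consist exactly of the entries 1, 2, …, ℓ, then every column of T contains an entry strictly greater than ℓ, and in each column the smallest entry strictly greater than ℓ equals ℓ+1. -/

import Mathlib

/-- `IsRectSSYT m ℓ e`: `e` is (the entry function of) a semistandard Young
tableau of rectangular shape `(m^ℓ)`.  Rows `i < ℓ` and columns `j < m` are
0-indexed; entries are positive integers, rows weakly increase, columns strictly
increase, and `e` vanishes outside the rectangle (so that the filling inside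
the shape determines `e`). -/
def IsRectSSYT (m ℓ : ℕ) (e : ℕ → ℕ → ℕ) : Prop :=
  (∀ i j, i < ℓ → j < m → 1 ≤ e i j) ∧
  (∀ i j j', i < ℓ → j ≤ j' → j' < m → e i j ≤ e i j') ∧
  (∀ i i' j, i < i' → i' < ℓ → j < m → e i j < e i' j) ∧
  (∀ i j, ℓ ≤ i ∨ m ≤ j → e i j = 0)

/-- The column word of a rectangular tableau: read each column from top to
bottom, starting with the rightmost column and moving left. -/
def colWord (m ℓ : ℕ) (e : ℕ → ℕ → ℕ) : List ℕ :=
  ((List.range m).reverse.flatMap fun j => (List.range ℓ).map fun i => e i j)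

/-- The number `k` acts on a Young diagram, given by its (1-indexed) part
function `lam : ℕ → ℕ`, by adding one box to the `k`-th row. -/
def addBox (lam : ℕ → ℕ) (k : ℕ) : ℕ → ℕ :=
  fun a => if a = k then lam k + 1 else lam a

/-- The action of `k` on `lam` is legal iff `k = 1` or `λ_k < λ_{k−1}`. -/
def LegalBox (lam : ℕ → ℕ) (k : ℕ) : Prop :=
  k = 1 ∨ lam k < lam (k - 1)

/-- The diagram obtained by letting a word act (left to right). -/
def actWord (lam : ℕ → ℕ) : List ℕ → (ℕ → ℕ)
  | [] => lam
  | k :: w => actWord (addBox lam k) w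

/-- A word acts legally iff each successive letter acts legally. -/
def LegalWord (lam : ℕ → ℕ) : List ℕ → Prop
  | [] => True
  | k :: w => LegalBox lam k ∧ LegalWord (addBox lam k) w

/-- The rectangular Young diagram `(m^ℓ)` as a 1-indexed part function. -/
def rectDiagram (m ℓ : ℕ) : ℕ → ℕ :=
  fun a => if 1 ≤ a ∧ a ≤ ℓ then m else 0

theorem actWord_apply (w : List ℕ) (lam : ℕ → ℕ) (k : ℕ) :
    actWord lam w k = lam k + w.count k := by
  induction w generalizing lam with
  | nil => simp [actWord]
  | cons a w ih =>
    rw [actWord, ih, List.count_cons]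
    by_cases h : k = a
    · subst h
      simp [addBox]
      omega
    · simp [addBox, h, Ne.symm h]

theorem LegalWord.legalBox_of_append {lam : ℕ → ℕ} {u w : List ℕ} {k : ℕ}
    (h : LegalWord lam (u ++ k :: w)) : LegalBox (actWord lam u) k := by
  induction u generalizing lam with
  | nil => exact h.1
  | cons a u ih => exact ih h.2

/-- The word of the `j`-th column of a filling with `ℓ` rows. -/
def singleColWord (ℓ : ℕ) (e : ℕ → ℕ → ℕ) (j : ℕ) : List ℕ :=
  (List.range ℓ).map fun i => e i j

theorem mem_singleColWord {ℓ : ℕ} {e : ℕ → ℕ → ℕ} {j k : ℕ} :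
    k ∈ singleColWord ℓ e j ↔ ∃ i < ℓ, e i j = k := by
  simp [singleColWord]

theorem IsRectSSYT.nodup_singleColWord {m ℓ : ℕ} {e : ℕ → ℕ → ℕ} (he : IsRectSSYT m ℓ e)
    {j : ℕ} (hj : j < m) : (singleColWord ℓ e j).Nodup := by
  refine List.Nodup.map_on ?_ List.nodup_range
  intro x hx y hy hxy
  rw [List.mem_range] at hx hy
  rcases lt_trichotomy x y with h | h | h
  · have := he.2.2.1 x y j h hy hj
    omega
  · exact h
  · have := he.2.2.1 y x j h hx hj
    omega

theorem range_eq_append_cons {n i : ℕ} (hi : i < n) :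
    ∃ t : List ℕ, List.range n = List.range i ++ i :: t ∧ ∀ x ∈ t, i < x ∧ x < n := by
  obtain ⟨d, rfl⟩ : ∃ d, n = i + 1 + d := ⟨n - (i + 1), by omega⟩
  refine ⟨(List.range d).map (i + 1 + ·), ?_, ?_⟩
  · rw [List.range_add, List.range_succ]
    simp
  · intro x hx
    simp only [List.mem_map, List.mem_range] at hx
    omega

theorem colWord_eq_append_cons {m ℓ i j : ℕ} (e : ℕ → ℕ → ℕ) (hi : i < ℓ) (hj : j < m) :
    ∃ t w : List ℕ, (∀ x ∈ t, j < x ∧ x < m) ∧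
      colWord m ℓ e = (t.flatMap (singleColWord ℓ e) ++ (List.range i).map fun i' => e i' j) ++
        e i j :: w := by
  obtain ⟨t, ht, htm⟩ := range_eq_append_cons hj
  obtain ⟨s, hs, -⟩ := range_eq_append_cons hi
  refine ⟨t.reverse, (s.map fun i' => e i' j) ++
    (List.range j).reverse.flatMap (singleColWord ℓ e), by simpa using htm, ?_⟩
  change (List.range m).reverse.flatMap (singleColWord ℓ e) = _
  have hcol : singleColWord ℓ e j =
      ((List.range i).map fun i' => e i' j) ++ e i j :: s.map fun i' => e i' j := by
    simp [singleColWord, hs]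
  rw [ht]
  simp [hcol, List.flatMap_append]

theorem count_flatMap_le_count_flatMap {t : List ℕ} {f : ℕ → List ℕ} {a b : ℕ}
    (h : ∀ x ∈ t, (f x).count a ≤ (f x).count b) :
    (t.flatMap f).count a ≤ (t.flatMap f).count b := by
  rw [List.count_flatMap, List.count_flatMap]
  exact List.sum_le_sum h

/-- A legal rectangular tableau has no gaps in the part of a column lying above `ℓ`. -/
theorem IsRectSSYT.exists_eq_of_le {m ℓ : ℕ} {e : ℕ → ℕ → ℕ} (he : IsRectSSYT m ℓ e)
    (hleg : LegalWord (rectDiagram m ℓ) (colWord m ℓ e)) {i j v : ℕ} (hi : i < ℓ) (hj : j < m)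
    (hv : ℓ < v) (hvi : v ≤ e i j) : ∃ i' < ℓ, e i' j = v := by
  induction hd : m - j using Nat.strong_induction_on generalizing i j v with
  | _ d ih =>
  subst hd
  induction h : e i j - v generalizing v with
  | zero => exact ⟨i, hi, by omega⟩
  | succ n ihn =>
    obtain ⟨r, hr, hre⟩ := ihn (v := v + 1) (by omega) (by omega) (by omega)
    by_contra hno
    obtain ⟨t, w, ht, hw⟩ := colWord_eq_append_cons e hr hj
    rw [hw] at hleg
    have hbox := hleg.legalBox_of_append
    rw [hre] at hbox
    rcases hbox with hbox | hbox
    · omega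
    rw [actWord_apply, actWord_apply, Nat.add_sub_cancel, List.count_append,
      List.count_append] at hbox
    have hz : ((List.range r).map fun i' => e i' j).count v = 0 := by
      rw [List.count_eq_zero]
      simp only [List.mem_map, List.mem_range, not_exists, not_and]
      exact fun x hx hxv => hno ⟨x, by omega, hxv⟩
    have hle : (t.flatMap (singleColWord ℓ e)).count v ≤
        (t.flatMap (singleColWord ℓ e)).count (v + 1) := by
      refine count_flatMap_le_count_flatMap fun x hx => ?_
      obtain ⟨hjx, hxm⟩ := ht x hx
      have hrow := he.2.1 r j x hr hjx.le hxm
      have hmem : v + 1 ∈ singleColWord ℓ e x :=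
        mem_singleColWord.2 (ih (m - x) (by omega) hr hxm (by omega) (by omega) rfl)
      exact (List.nodup_iff_count_le_one.1 (he.nodup_singleColWord hxm) v).trans
        (List.count_pos_iff.2 hmem)
    have h1 : rectDiagram m ℓ v = 0 := by simp [rectDiagram]; omega
    omega

theorem IsRectSSYT.add_le_entry_add {m ℓ : ℕ} {e : ℕ → ℕ → ℕ} (he : IsRectSSYT m ℓ e) {i j : ℕ}
    (hj : j < m) (d : ℕ) (hid : i + d < ℓ) : e i j + d ≤ e (i + d) j := by
  induction d with
  | zero => simp
  | succ d ih =>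
    have h1 := ih (by omega)
    have h2 := he.2.2.1 (i + d) (i + (d + 1)) j (by omega) hid hj
    omega

theorem IsRectSSYT.succ_le_entry {m ℓ : ℕ} {e : ℕ → ℕ → ℕ} (he : IsRectSSYT m ℓ e) {i j : ℕ}
    (hi : i < ℓ) (hj : j < m) : i + 1 ≤ e i j := by
  have h1 := he.add_le_entry_add (i := 0) hj i (by omega)
  have h2 := he.1 0 j (by omega) hj
  rw [Nat.zero_add] at h1
  omega

/-- If `T ∈ SSYT((m^ℓ))` acts legally on `Y((m^ℓ))` via its column word and the
leftmost column of `T` is not exactly `1, 2, …, ℓ`, then every column of `T`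
contains an entry strictly greater than `ℓ`, and in each column the smallest
entry strictly greater than `ℓ` equals `ℓ + 1`. -/
theorem rect_ssyt_column_min_entry (m ℓ : ℕ) (hm : 1 ≤ m) (hl : 1 ≤ ℓ)
    (e : ℕ → ℕ → ℕ) (he : IsRectSSYT m ℓ e)
    (hleg : LegalWord (rectDiagram m ℓ) (colWord m ℓ e))
    (hcol : ¬ ∀ i < ℓ, e i 0 = i + 1) :
    ∀ j < m, (∃ i < ℓ, ℓ < e i j) ∧
      (∃ i < ℓ, e i j = ℓ + 1 ∧ ∀ i' < ℓ, ℓ < e i' j → ℓ + 1 ≤ e i' j) := by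
  intro j hj
  have hlast : ℓ < e (ℓ - 1) j := by
    have hrow := he.2.1 (ℓ - 1) 0 j (by omega) (Nat.zero_le j) hj
    by_contra hle
    refine hcol fun i hi => ?_
    have h1 := he.succ_le_entry hi hm
    have h2 := he.add_le_entry_add (i := i) hm (ℓ - 1 - i) (by omega)
    rw [show i + (ℓ - 1 - i) = ℓ - 1 by omega] at h2
    omega
  obtain ⟨i, hi, hie⟩ := he.exists_eq_of_le hleg (by omega) hj (Nat.lt_succ_self ℓ) hlast
  exact ⟨⟨ℓ - 1, by omega, hlast⟩, i, hi, hie, fun _ _ h => h⟩
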